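/- Schur–Weyl reciprocity (second half): the centralizer in End_K(V^{⊗r}) of the subalgebra 𝒜_q equals the subalgebra ℬ_q; that is, { X ∈ End_K(V^{⊗r}) : XY = YX for all Y ∈ 𝒜_q } = ℬ_q. -/

import Mathlib

set_option synthInstance.maxHeartbeats 1000000
set_option maxHeartbeats 1000000

open scoped BigOperators Kronecker

section CommonDefs

variable {R : Type*} [CommRing R]

/-- ℤ₂-degree of the basis vector `v_{k+1}` (0-based index `k`): `0` if `k < m`, else `1`. -/
def deg (m : ℕ) {N : ℕ} (k : Fin N) : ℕ := if (k : ℕ) < m then 0 else 1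

/-- The sign `(−1)^{|v_k||v_l|}`. -/
def sgn (R : Type*) [CommRing R] (m : ℕ) {N : ℕ} (k l : Fin N) : R :=
  (-1 : R) ^ (deg m k * deg m l)

/-- Entries (row = input vector) of the operator `T` on `V ⊗ V`, where `x` plays the
role of `q` and `xinv` that of `q⁻¹`:  `T(v_k ⊗ v_k) = q·v_k ⊗ v_k` if `k ≤ m`,
`T(v_k ⊗ v_k) = −q⁻¹·v_k ⊗ v_k` if `k > m`,
`T(v_k ⊗ v_l) = (−1)^{|v_k||v_l|} v_l ⊗ v_k + (q−q⁻¹) v_k ⊗ v_l` if `k < l`, and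
`T(v_k ⊗ v_l) = (−1)^{|v_k||v_l|} v_l ⊗ v_k` if `k > l`. -/
def Tent (x xinv : R) (m : ℕ) {N : ℕ} (p p' : Fin N × Fin N) : R :=
  if p.1 = p.2 then (if (p.1 : ℕ) < m then x else -xinv) * (if p' = p then 1 else 0)
  else if (p.1 : ℕ) < (p.2 : ℕ) then
    sgn R m p.1 p.2 * (if p' = (p.2, p.1) then 1 else 0)
      + (x - xinv) * (if p' = p then 1 else 0)
  else sgn R m p.1 p.2 * (if p' = (p.2, p.1) then 1 else 0)

/-- Entries of the signed swap `P(v_k ⊗ v_l) = (−1)^{|v_k||v_l|} v_l ⊗ v_k`. -/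
def Pent (R : Type*) [CommRing R] (m : ℕ) {N : ℕ} (p p' : Fin N × Fin N) : R :=
  sgn R m p.1 p.2 * (if p' = (p.2, p.1) then 1 else 0)

/-- The operator `Id^{⊗ i} ⊗ E ⊗ Id^{⊗ (r−i−2)}` on `V^{⊗ r}` obtained from a two-site
operator `E` acting on the (0-based) tensor positions `i` and `i+1`. -/
def twoSiteOp {N : ℕ} (E : Fin N × Fin N → Fin N × Fin N → R) (r i : ℕ) (h : i + 1 < r) :
    Matrix (Fin r → Fin N) (Fin r → Fin N) R := fun a b =>
  E (a ⟨i, Nat.lt_of_succ_lt h⟩, a ⟨i + 1, h⟩) (b ⟨i, Nat.lt_of_succ_lt h⟩, b ⟨i + 1, h⟩) *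
    ∏ j ∈ Finset.univ \ ({⟨i, Nat.lt_of_succ_lt h⟩, ⟨i + 1, h⟩} : Finset (Fin r)),
      (if a j = b j then (1 : R) else 0)

/-- The Hecke operator `T_{i+1} = Id^{⊗ i} ⊗ T ⊗ Id^{⊗ (r−i−2)}` on `V^{⊗ r}`
(here `i` is the 0-based position of the first tensor factor it acts on). -/
def heckeOp (x xinv : R) (m : ℕ) {N : ℕ} (r i : ℕ) (h : i + 1 < r) :
    Matrix (Fin r → Fin N) (Fin r → Fin N) R :=
  twoSiteOp (Tent x xinv m) r i h

/-- The signed swap operator `P_{i+1} = Id^{⊗ i} ⊗ P ⊗ Id^{⊗ (r−i−2)}` on `V^{⊗ r}`. -/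
def swapOp (R : Type*) [CommRing R] (m : ℕ) {N : ℕ} (r i : ℕ) (h : i + 1 < r) :
    Matrix (Fin r → Fin N) (Fin r → Fin N) R :=
  twoSiteOp (Pent R m) r i h

/-- The parity operator `S v_j = (−1)^{|v_j|} v_j`. -/
def Smat (R : Type*) [CommRing R] (m : ℕ) {N : ℕ} : Matrix (Fin N) (Fin N) R :=
  fun a b => if a = b then (-1 : R) ^ deg m a else 0

/-- The diagonal operator `Q_b v_j = q^{δ_{bj}} v_j` (`x` playing the role of `q`, or of
`q⁻¹` for the inverse operator). -/
def Qmat (x : R) {N : ℕ} (b0 : Fin N) : Matrix (Fin N) (Fin N) R :=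
  fun a b => if a = b then (if a = b0 then x else 1) else 0

/-- `E_k v_{k+1} = v_k`, `E_k v_j = 0` otherwise (0-based `k`; row = input). -/
def Emat (R : Type*) [CommRing R] {N : ℕ} (k : ℕ) : Matrix (Fin N) (Fin N) R :=
  fun a b => if (a : ℕ) = k + 1 ∧ (b : ℕ) = k then 1 else 0

/-- `F_k v_k = v_{k+1}`, `F_k v_j = 0` otherwise (0-based `k`; row = input). -/
def Fmat (R : Type*) [CommRing R] {N : ℕ} (k : ℕ) : Matrix (Fin N) (Fin N) R :=
  fun a b => if (a : ℕ) = k ∧ (b : ℕ) = k + 1 then 1 else 0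

/-- The diagonal operator `D_k v_j = q^{s(k)δ_{kj} − s(k+1)δ_{k+1,j}} v_j`
(0-based `k`, so `s(k) = 1` iff `k < m`, and `s(k) = −1` otherwise). -/
def Dmat (x xinv : R) (m : ℕ) {N : ℕ} (k : ℕ) : Matrix (Fin N) (Fin N) R :=
  fun a b => if a = b then
    (if (a : ℕ) = k then (if k < m then x else xinv)
     else if (a : ℕ) = k + 1 then (if k + 1 < m then xinv else x) else 1)
  else 0

/-- The inverse `D_k⁻¹` of `Dmat` (obtained by exchanging `q` and `q⁻¹`). -/
def Dinvmat (x xinv : R) (m : ℕ) {N : ℕ} (k : ℕ) : Matrix (Fin N) (Fin N) R :=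
  Dmat xinv x m k

/-- `S^{p(k)}`, where `p(k) = 1` if the 0-based `k` satisfies `k + 1 = m` (the odd simple
root) and `p(k) = 0` otherwise. -/
def SPmat (R : Type*) [CommRing R] (m : ℕ) {N : ℕ} (k : ℕ) : Matrix (Fin N) (Fin N) R :=
  if k + 1 = m then Smat R m else 1

/-- Kronecker (tensor) product of `r` one-site operators, as a matrix on `V^{⊗ r}`. -/
def kron {N r : ℕ} (M : Fin r → Matrix (Fin N) (Fin N) R) :
    Matrix (Fin r → Fin N) (Fin r → Fin N) R :=
  fun a b => ∏ j, M j (a j) (b j)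

/-- `ρ_r(σ) = S^{⊗ r}`. -/
def rhoSigma (R : Type*) [CommRing R] (m : ℕ) {N : ℕ} (r : ℕ) :
    Matrix (Fin r → Fin N) (Fin r → Fin N) R :=
  kron fun _ => Smat R m

/-- `ρ_r(q^{δ_b}) = Q_b^{⊗ r}` (and its inverse, substituting `q⁻¹` for `x`). -/
def rhoQ (x : R) {N : ℕ} (r : ℕ) (b0 : Fin N) :
    Matrix (Fin r → Fin N) (Fin r → Fin N) R :=
  kron fun _ => Qmat x b0

/-- `ρ_r(e_k) = Σ_{j=1}^{r} (S^{p(k)})^{⊗(j−1)} ⊗ E_k ⊗ (D_k^{−1})^{⊗(r−j)}`. -/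
def rhoE (x xinv : R) (m : ℕ) {N : ℕ} (r : ℕ) (k : ℕ) :
    Matrix (Fin r → Fin N) (Fin r → Fin N) R :=
  ∑ p : Fin r, kron fun j =>
    if j < p then SPmat R m k else if j = p then Emat R k else Dinvmat x xinv m k

/-- `ρ_r(f_k) = Σ_{j=1}^{r} (S^{p(k)}D_k)^{⊗(j−1)} ⊗ F_k ⊗ Id^{⊗(r−j)}`. -/
def rhoF (x xinv : R) (m : ℕ) {N : ℕ} (r : ℕ) (k : ℕ) :
    Matrix (Fin r → Fin N) (Fin r → Fin N) R :=
  ∑ p : Fin r, kron fun j =>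
    if j < p then SPmat R m k * Dmat x xinv m k else if j = p then Fmat R k else 1

/-- The generators `T_1, …, T_{r−1}` of the image of the sign `q`-permutation
representation of the Iwahori–Hecke algebra on `V^{⊗ r}`. -/
def heckeGens (x xinv : R) (m : ℕ) {N : ℕ} (r : ℕ) :
    Set (Matrix (Fin r → Fin N) (Fin r → Fin N) R) :=
  {M | ∃ (i : ℕ) (h : i + 1 < r), M = heckeOp x xinv m r i h}

/-- The signed-swap generators `P_1, …, P_{r−1}` (the `q → 1` specialization). -/
def swapGens (R : Type*) [CommRing R] (m : ℕ) {N : ℕ} (r : ℕ) :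
    Set (Matrix (Fin r → Fin N) (Fin r → Fin N) R) :=
  {M | ∃ (i : ℕ) (h : i + 1 < r), M = swapOp R m r i h}

/-- The generators `ρ_r(σ)`, `ρ_r(q^{± δ_b})` (`1 ≤ b ≤ N`), `ρ_r(e_k)`, `ρ_r(f_k)`
(`1 ≤ k ≤ N−1`) of the image of the vector representation of `U_q^σ(gl(m,n))`. -/
def quantumGens (x xinv : R) (m : ℕ) {N : ℕ} (r : ℕ) :
    Set (Matrix (Fin r → Fin N) (Fin r → Fin N) R) :=
  {rhoSigma R m r} ∪ (Set.range fun b : Fin N => rhoQ x r b)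
    ∪ (Set.range fun b : Fin N => rhoQ xinv r b)
    ∪ (Set.range fun k : Fin (N - 1) => rhoE x xinv m r (k : ℕ))
    ∪ (Set.range fun k : Fin (N - 1) => rhoF x xinv m r (k : ℕ))

end CommonDefs

/-- The base field `K = ℚ(q)` of rational functions over `ℚ`. -/
abbrev 𝕂 : Type := RatFunc ℚ

/-- The indeterminate `q` of `K = ℚ(q)`. -/
noncomputable def q : 𝕂 := RatFunc.X

/-- `𝒜_q`: the image of the sign `q`-permutation representation of the Iwahori–Hecke
algebra `H_{K,r}(q)`, i.e. the `K`-subalgebra of `End_K(V^{⊗ r})` generated by the Hecke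
operators `T_1, …, T_{r−1}`. -/
noncomputable def Aq (m n r : ℕ) :
    Subalgebra 𝕂 (Module.End 𝕂 ((Fin r → Fin (m + n)) → 𝕂)) :=
  Algebra.adjoin 𝕂 (Matrix.vecMulLinear '' heckeGens q q⁻¹ m (N := m + n) r)

/-- `ℬ_q`: the image of the vector representation of `U_q^σ(gl(m,n))`, i.e. the
`K`-subalgebra of `End_K(V^{⊗ r})` generated by `ρ_r(σ)`, `ρ_r(q^{±δ_b})`
(`1 ≤ b ≤ m+n`), `ρ_r(e_k)` and `ρ_r(f_k)` (`1 ≤ k ≤ m+n−1`). -/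
noncomputable def Bq (m n r : ℕ) :
    Subalgebra 𝕂 (Module.End 𝕂 ((Fin r → Fin (m + n)) → 𝕂)) :=
  Algebra.adjoin 𝕂 (Matrix.vecMulLinear '' quantumGens q q⁻¹ m (N := m + n) r)

/-- The subring of pairs `(f, a)` such that the rational function `f` is regular at `1` with
value `a`. -/
def valueAtOne : Subring (𝕂 × ℚ) where
  carrier := {z | ∃ p c : Polynomial ℚ, c.eval 1 = 1 ∧ algebraMap _ 𝕂 c * z.1 = algebraMap _ 𝕂 p ∧
    p.eval 1 = z.2}
  mul_mem' := by
    rintro ⟨f, a⟩ ⟨g, b⟩ ⟨p, c, hc, h, hp⟩ ⟨p', c', hc', h', hp'⟩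
    refine ⟨p * p', c * c', by simp [hc, hc'], ?_, by simp [hp, hp']⟩
    simp only [map_mul, Prod.fst_mul, ← h, ← h']
    ring
  one_mem' := ⟨1, 1, by simp⟩
  add_mem' := by
    rintro ⟨f, a⟩ ⟨g, b⟩ ⟨p, c, hc, h, hp⟩ ⟨p', c', hc', h', hp'⟩
    refine ⟨c' * p + c * p', c * c', by simp [hc, hc'], ?_, by simp [hc, hc', hp, hp']⟩
    simp only [map_mul, map_add, Prod.fst_add, ← h, ← h']
    ring
  zero_mem' := ⟨0, 1, by simp⟩
  neg_mem' := by
    rintro ⟨f, a⟩ ⟨p, c, hc, h, hp⟩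
    exact ⟨-p, c, hc, by simp [← h], by simp [hp]⟩

theorem polynomial_mem_valueAtOne (p : Polynomial ℚ) :
    (algebraMap _ 𝕂 p, p.eval 1) ∈ valueAtOne := ⟨p, 1, by simp⟩

theorem const_mem_valueAtOne (a : ℚ) : (algebraMap ℚ 𝕂 a, a) ∈ valueAtOne := by
  have := polynomial_mem_valueAtOne (Polynomial.C a)
  rw [Polynomial.eval_C] at this
  rwa [← Polynomial.algebraMap_eq, ← IsScalarTower.algebraMap_apply] at this

theorem q_mem_valueAtOne : (q, 1) ∈ valueAtOne := by
  simpa [q] using polynomial_mem_valueAtOne Polynomial.X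

theorem q_ne_zero : q ≠ 0 := RatFunc.X_ne_zero

theorem q_inv_mem_valueAtOne : (q⁻¹, 1) ∈ valueAtOne :=
  ⟨1, Polynomial.X, by simp, by simpa [q] using mul_inv_cancel₀ q_ne_zero, by simp⟩

theorem q_sub_one_ne_zero : q - 1 ≠ 0 := by
  have : q - 1 = algebraMap _ 𝕂 (Polynomial.X - Polynomial.C (1 : ℚ)) := by simp [q]
  rw [this]
  exact RatFunc.algebraMap_ne_zero (Polynomial.X_sub_C_ne_zero 1)

theorem geom_mem_valueAtOne (c : ℕ) : ((q - 1)⁻¹ * (q ^ c - 1), (c : ℚ)) ∈ valueAtOne := by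
  have h : (q - 1)⁻¹ * (q ^ c - 1) = ∑ i ∈ Finset.range c, q ^ i := by
    rw [← mul_geom_sum, inv_mul_cancel_left₀ q_sub_one_ne_zero]
  have := sum_mem (S := valueAtOne) (t := Finset.range c) (f := fun i => (q, 1) ^ i)
    fun i _ => pow_mem q_mem_valueAtOne i
  rw [h]
  convert this using 1
  ext <;> simp [Prod.fst_sum, Prod.snd_sum]

theorem eq_zero_of_mem_valueAtOne {a : ℚ} (h : (0, a) ∈ valueAtOne) : a = 0 := by
  obtain ⟨p, c, -, h, hp⟩ := h
  have : p = 0 := by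
    apply RatFunc.algebraMap_injective ℚ
    simpa using h.symm
  simp_all

theorem exists_common_denom {ι : Type*} [Fintype ι] {f : ι → 𝕂} {a : ι → ℚ}
    (h : ∀ i, (f i, a i) ∈ valueAtOne) :
    ∃ (c : Polynomial ℚ) (p : ι → Polynomial ℚ),
      (∀ i, algebraMap _ 𝕂 c * f i = algebraMap _ 𝕂 (p i)) ∧ ∀ i, (p i).eval 1 = a i := by
  choose p c hc h hp using h
  choose d hd using fun i => Finset.dvd_prod_of_mem c (Finset.mem_univ i)
  have h1 : (∏ i, c i).eval 1 = 1 := by simp [Polynomial.eval_prod, hc]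
  refine ⟨∏ i, c i, fun i => d i * p i, fun i => ?_, fun i => ?_⟩
  · rw [hd i, map_mul, map_mul, ← h i]
    ring
  · have := congrArg (Polynomial.eval 1) (hd i)
    rw [h1, Polynomial.eval_mul, hc, one_mul] at this
    simp [← this, hp]

/-- If every polynomial point of `C` agrees at `q = 1` with some regular point of `B ≤ C`, then
`B = C`. -/
theorem le_of_specialization {ι : Type*} [Fintype ι] {B C : Submodule 𝕂 (ι → 𝕂)} (hBC : B ≤ C)
    (h : ∀ P : ι → Polynomial ℚ, (fun i => algebraMap _ 𝕂 (P i)) ∈ C →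
      ∃ b ∈ B, ∀ i, (b i, (P i).eval 1) ∈ valueAtOne) : C ≤ B := by
  let φ : (ι → Polynomial ℚ) →ₗ[Polynomial ℚ] (ι → 𝕂) :=
    (Algebra.linearMap (Polynomial ℚ) 𝕂).compLeft ι
  let LB := (B.restrictScalars (Polynomial ℚ)).comap φ
  let LC := (C.restrictScalars (Polynomial ℚ)).comap φ
  have hsm (W : Submodule 𝕂 (ι → 𝕂)) (c : Polynomial ℚ) (hc : c ≠ 0) (v : ι → 𝕂)
      (hv : c • v ∈ W) : v ∈ W := by
    rw [← algebraMap_smul 𝕂 c v] at hv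
    exact (W.smul_mem_iff (RatFunc.algebraMap_ne_zero hc)).1 hv
  let I : Ideal (Polynomial ℚ) := Ideal.span {Polynomial.X - Polynomial.C 1}
  have hle : LC ≤ LB ⊔ I • LC := by
    intro P hP
    obtain ⟨b, hb, hbP⟩ := h P hP
    obtain ⟨c, p, hcp, hp⟩ := exists_common_denom hbP
    have hpB : p ∈ LB := by
      change φ p ∈ B
      have : φ p = algebraMap _ 𝕂 c • b := by
        ext i
        simp [φ, ← hcp]
      rw [this]
      exact B.smul_mem _ hb
    have hdvd i : (Polynomial.X - Polynomial.C 1 : Polynomial ℚ) ∣ P i - p i := by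
      rw [Polynomial.dvd_iff_isRoot]
      simp [hp]
    choose Z hZ using hdvd
    have hPZ : P - p = (Polynomial.X - Polynomial.C 1 : Polynomial ℚ) • Z := by
      ext1 i
      simpa using hZ i
    have hZC : Z ∈ LC := by
      have h1 : (Polynomial.X - Polynomial.C 1 : Polynomial ℚ) • Z ∈ LC := by
        rw [← hPZ]
        exact LC.sub_mem hP (hBC hpB)
      change φ _ ∈ C at h1
      rw [map_smul] at h1
      exact hsm C _ (Polynomial.X_sub_C_ne_zero 1) _ h1
    have : P = p + (Polynomial.X - Polynomial.C 1 : Polynomial ℚ) • Z := by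
      rw [← hPZ]
      abel
    rw [this]
    exact Submodule.add_mem_sup hpB
      (Submodule.smul_mem_smul (Ideal.mem_span_singleton_self _) hZC)
  obtain ⟨s, hs, hsL⟩ := Submodule.exists_sub_one_mem_and_smul_le_of_fg_of_le_sup
    (IsNoetherian.noetherian LC) le_rfl hle
  have hs0 : s ≠ 0 := by
    rintro rfl
    rw [Ideal.mem_span_singleton, Polynomial.dvd_iff_isRoot] at hs
    simp at hs
  intro v hv
  obtain ⟨c, hc⟩ := IsLocalization.exist_integer_multiples_of_finite
    (nonZeroDivisors (Polynomial ℚ)) v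
  choose P hP using hc
  have hφ : φ P = (c : Polynomial ℚ) • v := by
    ext1 i
    exact hP i
  have hPC : P ∈ LC := by
    change φ P ∈ C
    rw [hφ, ← algebraMap_smul 𝕂 (c : Polynomial ℚ) v]
    exact C.smul_mem _ hv
  have hsP : φ (s • P) ∈ B := hsL (Submodule.smul_mem_pointwise_smul _ _ _ hPC)
  rw [map_smul, hφ] at hsP
  exact hsm B _ (nonZeroDivisors.coe_ne_zero c) _ (hsm B _ hs0 _ hsP)

section Symmetrization

variable {k 𝓐 X : Type*} [Field k] [Ring 𝓐] [Algebra k 𝓐] {r : ℕ}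

/-- The product `∏ u_{σ j}(x)` over the letters `(j, x)` of a word `w`. -/
def wordProd (u : Fin r → X → 𝓐) (σ : Equiv.Perm (Fin r)) (w : List (Fin r × X)) : 𝓐 :=
  (w.map fun p => u (σ p.1) p.2).prod

theorem wordProd_cons (u : Fin r → X → 𝓐) (σ : Equiv.Perm (Fin r)) (p : Fin r × X)
    (w : List (Fin r × X)) : wordProd u σ (p :: w) = u (σ p.1) p.2 * wordProd u σ w := by
  simp [wordProd]

theorem wordProd_append (u : Fin r → X → 𝓐) (σ : Equiv.Perm (Fin r)) (w w' : List (Fin r × X)) :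
    wordProd u σ (w ++ w') = wordProd u σ w * wordProd u σ w' := by
  simp [wordProd]

theorem wordProd_mul_swap (u : Fin r → X → 𝓐) (σ : Equiv.Perm (Fin r)) {i j : Fin r}
    {w : List (Fin r × X)} (hi : i ∉ w.map Prod.fst) (hj : j ∉ w.map Prod.fst) :
    wordProd u (σ * Equiv.swap i j) w = wordProd u σ w := by
  unfold wordProd
  congr 1
  apply List.map_congr_left
  intro p hp
  have hp' : p.1 ∈ w.map Prod.fst := List.mem_map_of_mem hp
  have h1 : p.1 ≠ i := fun h => hi (h ▸ hp')
  have h2 : p.1 ≠ j := fun h => hj (h ▸ hp')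
  simp [Equiv.swap_apply_of_ne_of_ne h1 h2]

theorem exists_mul_wordProd_eq {u : Fin r → X → 𝓐}
    (hcomm : ∀ x y, ∃ c : k, ∀ i j, i ≠ j → u i x * u j y = c • (u j y * u i x))
    (j : Fin r) (x : X) (w : List (Fin r × X)) (hj : j ∉ w.map Prod.fst) :
    ∃ c : k, ∀ σ, u (σ j) x * wordProd u σ w = c • (wordProd u σ w * u (σ j) x) := by
  induction w with
  | nil => exact ⟨1, by simp [wordProd]⟩
  | cons p w ih =>
    simp only [List.map_cons, List.mem_cons, not_or] at hj
    obtain ⟨c, hc⟩ := ih hj.2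
    obtain ⟨d, hd⟩ := hcomm x p.2
    refine ⟨d * c, fun σ => ?_⟩
    rw [wordProd_cons, ← mul_assoc, hd _ _ (σ.injective.ne hj.1), smul_mul_assoc, mul_assoc, hc,
      mul_smul_comm, smul_smul, mul_assoc]

/-- Symmetrized words in a family of one-site operators that commute up to scalars across sites
are polynomials in the sums `∑ j, u j x`. -/
theorem sum_wordProd_mem [CharZero k] {u : Fin r → X → 𝓐}
    (hcomm : ∀ x y, ∃ c : k, ∀ i j, i ≠ j → u i x * u j y = c • (u j y * u i x))
    (hmul : ∀ x y, ∃ (c : k) (z : X), ∀ j, u j x * u j y = c • u j z)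
    (B : Subalgebra k 𝓐) (hB : ∀ x, ∑ j, u j x ∈ B) (l : ℕ) :
    ∀ w : List (Fin r × X), w.length = l → ∑ σ, wordProd u σ w ∈ B := by
  induction l with
  | zero =>
    intro w hw
    rw [List.length_eq_zero_iff] at hw
    subst hw
    simp [wordProd]
  | succ l ih =>
    have hin (j : Fin r) (x : X) (w : List (Fin r × X)) (hw : w.length = l)
        (hj : j ∈ w.map Prod.fst) : ∑ σ, wordProd u σ ((j, x) :: w) ∈ B := by
      obtain ⟨w₁, w₂, y, rfl, hw₁⟩ : ∃ w₁ w₂ y, w = w₁ ++ (j, y) :: w₂ ∧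
          j ∉ w₁.map Prod.fst := by
        clear hw
        induction w with
        | nil => simp at hj
        | cons p w ihw =>
          by_cases hp : j = p.1
          · exact ⟨[], w, p.2, by simp [hp], by simp⟩
          · obtain ⟨w₁, w₂, y, rfl, h⟩ := ihw (by simpa [hp] using hj)
            exact ⟨p :: w₁, w₂, y, rfl, by simpa [hp] using h⟩
      obtain ⟨c, hc⟩ := exists_mul_wordProd_eq hcomm j x w₁ hw₁
      obtain ⟨d, z, hd⟩ := hmul x y
      have key : ∑ σ, wordProd u σ ((j, x) :: (w₁ ++ (j, y) :: w₂)) =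
          (c * d) • ∑ σ, wordProd u σ (w₁ ++ (j, z) :: w₂) := by
        rw [Finset.smul_sum]
        refine Finset.sum_congr rfl fun σ _ => ?_
        simp only [wordProd_cons, wordProd_append]
        rw [← mul_assoc, hc, smul_mul_assoc, mul_assoc, ← mul_assoc (u _ x), hd, smul_mul_assoc,
          mul_smul_comm, smul_smul]
      rw [key]
      exact B.smul_mem (ih _ (by simpa using hw)) _
    intro w hw
    obtain ⟨⟨j₀, x⟩, w, rfl⟩ := List.exists_cons_of_length_eq_add_one hw
    replace hw : w.length = l := by simpa using hw
    by_cases hj₀ : j₀ ∈ w.map Prod.fst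
    · exact hin j₀ x w hw hj₀
    have hprod : (∑ j, u j x) * ∑ σ, wordProd u σ w =
        ∑ j, ∑ σ, wordProd u σ ((j, x) :: w) := by
      rw [Finset.mul_sum, Finset.sum_comm]
      refine Finset.sum_congr rfl fun σ _ => ?_
      rw [Finset.sum_mul, ← Equiv.sum_comp σ]
      simp [wordProd_cons]
    have hout (j : Fin r) (hj : j ∉ w.map Prod.fst) : ∑ σ, wordProd u σ ((j, x) :: w) =
        ∑ σ, wordProd u σ ((j₀, x) :: w) := by
      rw [← Equiv.sum_comp (Equiv.mulRight (Equiv.swap j₀ j))]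
      refine Finset.sum_congr rfl fun σ _ => ?_
      simp only [wordProd_cons, Equiv.coe_mulRight, wordProd_mul_swap u σ hj₀ hj]
      simp
    rw [← Finset.sum_filter_add_sum_filter_not (M := 𝓐) _ (fun j => j ∈ w.map Prod.fst)
      (fun j => ∑ σ, wordProd u σ ((j, x) :: w)),
      Finset.sum_congr (s₁ := Finset.univ.filter fun j => j ∉ w.map Prod.fst) rfl
        (fun j hj => hout j (Finset.mem_filter.1 hj).2), Finset.sum_const] at hprod
    have hmem : (Finset.univ.filter fun j => j ∉ w.map Prod.fst).card •
        ∑ σ, wordProd u σ ((j₀, x) :: w) ∈ B := by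
      rw [← sub_eq_iff_eq_add'] at hprod
      rw [← hprod]
      exact B.sub_mem (B.mul_mem (hB x) (ih w hw))
        (B.sum_mem fun j hj => hin j x w hw (Finset.mem_filter.1 hj).2)
    have hcard : ((Finset.univ.filter fun j => j ∉ w.map Prod.fst).card : k) ≠ 0 := by
      rw [Nat.cast_ne_zero]
      exact Finset.card_ne_zero_of_mem (Finset.mem_filter.2 ⟨Finset.mem_univ j₀, hj₀⟩)
    rw [← Nat.cast_smul_eq_nsmul k] at hmem
    exact (B.toSubmodule.smul_mem_iff hcard).1 hmem

end Symmetrization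

section Kron

variable {R : Type*} [CommRing R] {N r : ℕ}

theorem kron_mul (M M' : Fin r → Matrix (Fin N) (Fin N) R) :
    kron M * kron M' = kron fun j => M j * M' j := by
  ext a b
  simp only [kron, Matrix.mul_apply, ← Finset.prod_mul_distrib]
  rw [Fintype.prod_sum]

theorem kron_one : kron (fun _ : Fin r => (1 : Matrix (Fin N) (Fin N) R)) = 1 := by
  ext a b
  simp only [kron, Matrix.one_apply]
  rw [Fintype.prod_ite_zero]
  simp [funext_iff]

theorem kron_smul (c : Fin r → R) (M : Fin r → Matrix (Fin N) (Fin N) R) :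
    kron (fun j => c j • M j) = (∏ j, c j) • kron M := by
  ext a b
  simp [kron, Finset.prod_mul_distrib]

theorem kron_eq_zero {M : Fin r → Matrix (Fin N) (Fin N) R} (j : Fin r) (h : M j = 0) :
    kron M = 0 := by
  ext a b
  exact Finset.prod_eq_zero (Finset.mem_univ j) (by simp [h])

theorem kron_single (a b : Fin r → Fin N) :
    kron (fun j => Matrix.single (a j) (b j) (1 : R)) = Matrix.single a b 1 := by
  ext c d
  simp only [kron, Matrix.single_apply]
  rw [Fintype.prod_ite_zero]
  simp [funext_iff, forall_and]

theorem kron_apply_eq_mul_prod (M : Fin r → Matrix (Fin N) (Fin N) R) (a b : Fin r → Fin N)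
    {i i' : Fin r} (h : i ≠ i') :
    kron M a b = M i (a i) (b i) * M i' (a i') (b i') *
      ∏ j ∈ Finset.univ \ {i, i'}, M j (a j) (b j) := by
  rw [kron, ← Finset.prod_sdiff (Finset.subset_univ {i, i'}), Finset.prod_pair h, mul_comm]

/-- An operator on `V^{⊗ r}` acting on the sites `i, i'` by
`v_k ⊗ v_l ↦ D(k,l) v_k ⊗ v_l + O(k,l) v_l ⊗ v_k`. -/
def swapForm (D O : Fin N → Fin N → R) (i i' : Fin r) :
    Matrix (Fin r → Fin N) (Fin r → Fin N) R := fun a b =>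
  D (a i) (a i') * (if a = b then 1 else 0) +
    O (a i) (a i') * (if a ∘ Equiv.swap i i' = b then 1 else 0)

theorem twoSiteOp_eq_swapForm (E : Fin N × Fin N → Fin N × Fin N → R) (D O : Fin N → Fin N → R)
    (hE : ∀ p p', E p p' = D p.1 p.2 * (if p = p' then 1 else 0) +
      O p.1 p.2 * (if (p.2, p.1) = p' then 1 else 0)) (i : ℕ) (h : i + 1 < r) :
    twoSiteOp E r i h = swapForm D O ⟨i, Nat.lt_of_succ_lt h⟩ ⟨i + 1, h⟩ := by
  ext a b
  simp only [twoSiteOp, swapForm, hE, add_mul, mul_assoc]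
  generalize hi : (⟨i, Nat.lt_of_succ_lt h⟩ : Fin r) = s
  generalize hi' : (⟨i + 1, h⟩ : Fin r) = t
  have hst : s ≠ t := by simp [← hi, ← hi', Fin.ext_iff]
  rw [Finset.prod_ite_zero, Finset.prod_const_one, ite_zero_mul_ite_zero, ite_zero_mul_ite_zero,
    mul_one]
  congr 3
  · apply propext
    simp only [Prod.mk.injEq, Finset.mem_sdiff, Finset.mem_univ, true_and, Finset.mem_insert,
      Finset.mem_singleton, not_or, and_imp, funext_iff]
    constructor
    · rintro ⟨⟨h1, h2⟩, h3⟩ j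
      by_cases hs : j = s
      · exact hs ▸ h1
      by_cases ht : j = t
      · exact ht ▸ h2
      exact h3 j hs ht
    · exact fun H => ⟨⟨H s, H t⟩, fun j _ _ => H j⟩
  · apply propext
    simp only [Prod.mk.injEq, Finset.mem_sdiff, Finset.mem_univ, true_and, Finset.mem_insert,
      Finset.mem_singleton, not_or, and_imp, funext_iff, Function.comp_apply]
    constructor
    · rintro ⟨⟨h1, h2⟩, h3⟩ j
      by_cases hs : j = s
      · subst hs
        simpa using h1
      by_cases ht : j = t
      · subst ht
        simpa using h2
      rw [Equiv.swap_apply_of_ne_of_ne hs ht]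
      exact h3 j hs ht
    · refine fun H => ⟨⟨by simpa using H s, by simpa using H t⟩, fun j hs ht => ?_⟩
      simpa [Equiv.swap_apply_of_ne_of_ne hs ht] using H j

theorem comp_swap_eq_iff {i i' : Fin r} {a b : Fin r → Fin N} :
    a ∘ Equiv.swap i i' = b ↔ a = b ∘ Equiv.swap i i' := by
  constructor <;> rintro rfl <;> ext j <;> simp

theorem swapForm_mul_apply (D O : Fin N → Fin N → R) (i i' : Fin r)
    (M : Matrix (Fin r → Fin N) (Fin r → Fin N) R) (a b : Fin r → Fin N) :
    (swapForm D O i i' * M) a b =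
      D (a i) (a i') * M a b + O (a i) (a i') * M (a ∘ Equiv.swap i i') b := by
  simp [Matrix.mul_apply, swapForm, add_mul, Finset.sum_add_distrib]

theorem mul_swapForm_apply (D O : Fin N → Fin N → R) (i i' : Fin r)
    (M : Matrix (Fin r → Fin N) (Fin r → Fin N) R) (a b : Fin r → Fin N) :
    (M * swapForm D O i i') a b =
      D (b i) (b i') * M a b + O (b i') (b i) * M a (b ∘ Equiv.swap i i') := by
  simp [Matrix.mul_apply, swapForm, mul_add, Finset.sum_add_distrib, comp_swap_eq_iff, mul_comm]

/-- A two-site operator `Δ`, given by `v_a ⊗ v_b ↦ ∑ Δ a b c d v_c ⊗ v_d`, intertwines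
`v_k ⊗ v_l ↦ D(k,l) v_k ⊗ v_l + O(k,l) v_l ⊗ v_k` on both sides, up to replacement by `Δ'`. -/
def Intertwines (D O : Fin N → Fin N → R) (Δ Δ' : Fin N → Fin N → Fin N → Fin N → R) : Prop :=
  ∀ a b c d, D a b * Δ a b c d + O a b * Δ b a c d = D c d * Δ' a b c d + O d c * Δ' a b d c

theorem swapForm_mul_sum_kron {ι : Type*} (s : Finset ι) {D O : Fin N → Fin N → R}
    {i i' : Fin r} (hi : i ≠ i') {M M' : ι → Fin r → Matrix (Fin N) (Fin N) R}
    {rest : Fin r → Matrix (Fin N) (Fin N) R}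
    (hM : ∀ p ∈ s, ∀ j, j ≠ i → j ≠ i' → M p j = rest j)
    (hM' : ∀ p ∈ s, ∀ j, j ≠ i → j ≠ i' → M' p j = rest j)
    (h : Intertwines D O (fun a b c d => ∑ p ∈ s, M p i a c * M p i' b d)
      (fun a b c d => ∑ p ∈ s, M' p i a c * M' p i' b d)) :
    swapForm D O i i' * ∑ p ∈ s, kron (M p) = (∑ p ∈ s, kron (M' p)) * swapForm D O i i' := by
  have key (M : ι → Fin r → Matrix (Fin N) (Fin N) R)
      (hM : ∀ p ∈ s, ∀ j, j ≠ i → j ≠ i' → M p j = rest j) (a b : Fin r → Fin N) :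
      (∑ p ∈ s, kron (M p)) a b = (∑ p ∈ s, M p i (a i) (b i) * M p i' (a i') (b i')) *
        ∏ j ∈ Finset.univ \ {i, i'}, rest j (a j) (b j) := by
    rw [Matrix.sum_apply, Finset.sum_mul]
    refine Finset.sum_congr rfl fun p hp => ?_
    rw [kron_apply_eq_mul_prod _ _ _ hi]
    congr 1
    refine Finset.prod_congr rfl fun j hj => ?_
    simp only [Finset.mem_sdiff, Finset.mem_univ, true_and, Finset.mem_insert,
      Finset.mem_singleton, not_or] at hj
    rw [hM p hp j hj.1 hj.2]
  have hne (j : Fin r) (hj : j ∈ Finset.univ \ ({i, i'} : Finset (Fin r))) :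
      Equiv.swap i i' j = j := by
    simp only [Finset.mem_sdiff, Finset.mem_univ, true_and, Finset.mem_insert,
      Finset.mem_singleton, not_or] at hj
    exact Equiv.swap_apply_of_ne_of_ne hj.1 hj.2
  ext a b
  rw [swapForm_mul_apply, mul_swapForm_apply, key M hM, key M hM, key M' hM', key M' hM']
  have h1 : ∏ j ∈ Finset.univ \ {i, i'}, rest j ((a ∘ Equiv.swap i i') j) (b j) =
      ∏ j ∈ Finset.univ \ {i, i'}, rest j (a j) (b j) :=
    Finset.prod_congr rfl fun j hj => by simp [hne j hj]
  have h2 : ∏ j ∈ Finset.univ \ {i, i'}, rest j (a j) ((b ∘ Equiv.swap i i') j) =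
      ∏ j ∈ Finset.univ \ {i, i'}, rest j (a j) (b j) :=
    Finset.prod_congr rfl fun j hj => by simp [hne j hj]
  rw [h1, h2, ← mul_assoc, ← mul_assoc, ← mul_assoc, ← mul_assoc, ← add_mul, ← add_mul]
  congr 1
  simpa using h (a i) (a i') (b i) (b i')

theorem swapForm_mul_kron {D O : Fin N → Fin N → R} {i i' : Fin r} (hi : i ≠ i')
    {M M' : Fin r → Matrix (Fin N) (Fin N) R}
    (hM : ∀ j, j ≠ i → j ≠ i' → M j = M' j)
    (h : Intertwines D O (fun a b c d => M i a c * M i' b d)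
      (fun a b c d => M' i a c * M' i' b d)) :
    swapForm D O i i' * kron M = kron M' * swapForm D O i i' := by
  have := swapForm_mul_sum_kron ({()} : Finset Unit) hi (M := fun _ => M) (M' := fun _ => M')
    (fun _ _ => hM) (fun _ _ _ _ _ => rfl) (by simpa using h)
  simpa using this

end Kron

section SiteOp

variable {R : Type*} [CommRing R] {N r : ℕ}

theorem Smat_eq_diagonal (m : ℕ) :
    Smat R m (N := N) = Matrix.diagonal fun a => (-1 : R) ^ deg m a := by
  ext a b
  simp [Smat, Matrix.diagonal_apply]

theorem Smat_pow_eq_diagonal (m n : ℕ) :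
    Smat R m (N := N) ^ n = Matrix.diagonal fun a => (-1 : R) ^ (n * deg m a) := by
  rw [Smat_eq_diagonal, Matrix.diagonal_pow]
  congr 1
  ext a
  simp [← pow_mul, mul_comm]

theorem Smat_pow_two_mul (m n : ℕ) : Smat R m (N := N) ^ (2 * n) = 1 := by
  rw [Smat_pow_eq_diagonal, ← Matrix.diagonal_one]
  congr 1
  ext a
  simp [mul_assoc]

theorem Smat_pow_mul_single (m n : ℕ) (a b : Fin N) :
    Smat R m ^ n * Matrix.single a b 1 = (-1 : R) ^ (n * deg m a) • Matrix.single a b (1 : R) := by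
  rw [Smat_pow_eq_diagonal]
  ext c d
  by_cases h : a = c <;> simp [Matrix.single_apply, h]

theorem single_mul_Smat_pow (m n : ℕ) (a b : Fin N) :
    Matrix.single a b 1 * Smat R m ^ n = (-1 : R) ^ (n * deg m b) • Matrix.single a b (1 : R) := by
  rw [Smat_pow_eq_diagonal]
  ext c d
  by_cases h : b = d <;> simp [Matrix.single_apply, h]

/-- The parity of the matrix unit `E_{x.1, x.2}` of `gl(m,n)`, as a natural number. -/
def unitDeg (m : ℕ) (x : Fin N × Fin N) : ℕ := deg m x.1 + deg m x.2

/-- The tensor factor at site `i` of the matrix unit `x` placed at site `j`. -/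
def siteFactor (R : Type*) [CommRing R] (m : ℕ) (j : Fin r) (x : Fin N × Fin N) (i : Fin r) :
    Matrix (Fin N) (Fin N) R :=
  if i < j then Smat R m ^ unitDeg m x else if i = j then Matrix.single x.1 x.2 1 else 1

/-- The operator `S^{|x|} ⊗ ⋯ ⊗ S^{|x|} ⊗ x ⊗ 1 ⊗ ⋯ ⊗ 1` with the matrix unit `x` at site `j`. -/
def siteOp (R : Type*) [CommRing R] (m : ℕ) (j : Fin r) (x : Fin N × Fin N) :
    Matrix (Fin r → Fin N) (Fin r → Fin N) R :=
  kron (siteFactor R m j x)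

theorem siteOp_mul_siteOp_of_ne (m : ℕ) (x y : Fin N × Fin N) {i j : Fin r} (hij : i ≠ j) :
    siteOp R m i x * siteOp R m j y =
      (-1 : R) ^ (unitDeg m x * unitDeg m y) • (siteOp R m j y * siteOp R m i x) := by
  have key (x y : Fin N × Fin N) : Matrix.single x.1 x.2 1 * Smat R m ^ unitDeg m y =
      (-1 : R) ^ (unitDeg m x * unitDeg m y) •
        (Smat R m ^ unitDeg m y * Matrix.single x.1 x.2 1) := by
    rw [Smat_pow_mul_single, single_mul_Smat_pow, smul_smul, ← pow_add]
    congr 1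
    have : unitDeg m x * unitDeg m y + unitDeg m y * deg m x.1 =
        2 * (unitDeg m y * deg m x.1) + unitDeg m y * deg m x.2 := by
      unfold unitDeg
      ring
    rw [this, pow_add, pow_mul]
    simp
  have hsq (e : ℕ) : ((-1 : R) ^ e) * (-1) ^ e = 1 := by
    rw [← mul_pow]
    simp
  have main (x y : Fin N × Fin N) {i j : Fin r} (hij : i < j) :
      siteOp R m i x * siteOp R m j y =
        (-1 : R) ^ (unitDeg m x * unitDeg m y) • (siteOp R m j y * siteOp R m i x) := by
    have h1 : (-1 : R) ^ (unitDeg m x * unitDeg m y) =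
        ∏ l : Fin r, if l = i then (-1 : R) ^ (unitDeg m x * unitDeg m y) else 1 := by simp
    simp only [siteOp, kron_mul]
    rw [h1, ← kron_smul]
    congr 1
    ext1 l
    rcases lt_trichotomy l i with h | rfl | h
    · have hc := (Commute.refl (Smat R m (N := N))).pow_pow (unitDeg m x) (unitDeg m y)
      simp [siteFactor, h, h.trans hij, h.ne, hc.eq]
    · simp [siteFactor, hij, key]
    · simp [siteFactor, h.not_gt, h.ne']
  rcases hij.lt_or_gt with h | h
  · exact main x y h
  · rw [main y x h, smul_smul, mul_comm (unitDeg m y), hsq, one_smul]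

theorem siteOp_mul_siteOp_self (m : ℕ) (j : Fin r) (a b c : Fin N) :
    siteOp R m j (a, b) * siteOp R m j (b, c) = siteOp R m j (a, c) := by
  rw [siteOp, siteOp, kron_mul, siteOp]
  congr 1
  ext1 i
  rcases lt_trichotomy i j with h | rfl | h
  · have : unitDeg m (a, b) + unitDeg m (b, c) = unitDeg m (a, c) + 2 * deg m b := by
      simp only [unitDeg]
      ring
    simp only [siteFactor, h, if_true]
    rw [← pow_add, this, pow_add, Smat_pow_two_mul, mul_one]
  · simp [siteFactor]
  · simp [siteFactor, h.not_gt, h.ne']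

theorem siteOp_mul_siteOp_eq_zero (m : ℕ) (j : Fin r) {b c : Fin N} (h : b ≠ c) (a d : Fin N) :
    siteOp R m j (a, b) * siteOp R m j (c, d) = 0 := by
  rw [siteOp, siteOp, kron_mul]
  exact kron_eq_zero j (by simp [siteFactor, h])

theorem kron_list_prod {ι : Type*} (l : List ι) (M : ι → Fin r → Matrix (Fin N) (Fin N) R) :
    (l.map fun p => kron (M p)).prod = kron fun j => (l.map fun p => M p j).prod := by
  induction l with
  | nil => simp [kron_one]
  | cons p l ih => simp [ih, kron_mul]

/-- The word of the matrix units `E_{a_j, b_j}` placed at the successive sites `j`. -/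
def unitWord (a b : Fin r → Fin N) : List (Fin r × (Fin N × Fin N)) :=
  (List.finRange r).map fun j => (j, (a j, b j))

theorem exists_wordProd_unitWord (m : ℕ) (a b : Fin r → Fin N) :
    ∃ e : ℕ, wordProd (siteOp R m) 1 (unitWord a b) = (-1 : R) ^ e • Matrix.single a b 1 := by
  have hnotin (i : Fin r) (l : List (Fin r)) (hi : i ∉ l) :
      ∃ e, (l.map fun j => siteFactor R m j (a j, b j) i).prod = Smat R m ^ e := by
    induction l with
    | nil => exact ⟨0, by simp⟩
    | cons j l ih =>
      simp only [List.mem_cons, not_or] at hi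
      obtain ⟨e, he⟩ := ih hi.2
      by_cases h : i < j
      · refine ⟨unitDeg m (a j, b j) + e, ?_⟩
        rw [List.map_cons, List.prod_cons, he, pow_add]
        simp [siteFactor, h]
      · refine ⟨e, ?_⟩
        rw [List.map_cons, List.prod_cons, he]
        simp [siteFactor, h, hi.1]
  have hin (i : Fin r) (l : List (Fin r)) (hl : l.Nodup) (hi : i ∈ l) :
      ∃ e : ℕ, (l.map fun j => siteFactor R m j (a j, b j) i).prod =
        (-1 : R) ^ e • Matrix.single (a i) (b i) 1 := by
    induction l with
    | nil => simp at hi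
    | cons j l ih =>
      rw [List.nodup_cons] at hl
      by_cases hij : i = j
      · subst hij
        obtain ⟨e, he⟩ := hnotin i l hl.1
        refine ⟨e * deg m (b i), ?_⟩
        rw [List.map_cons, List.prod_cons, he, ← single_mul_Smat_pow]
        simp [siteFactor]
      · obtain ⟨e, he⟩ := ih hl.2 (by simpa [hij] using hi)
        by_cases h : i < j
        · refine ⟨e + unitDeg m (a j, b j) * deg m (a i), ?_⟩
          rw [List.map_cons, List.prod_cons, he, pow_add, mul_smul, ← Smat_pow_mul_single,
            mul_smul_comm]
          simp [siteFactor, h]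
        · refine ⟨e, ?_⟩
          rw [List.map_cons, List.prod_cons, he]
          simp [siteFactor, h, hij]
  choose e he using fun i => hin i _ (List.nodup_finRange r) (List.mem_finRange i)
  refine ⟨∑ i, e i, ?_⟩
  have : wordProd (siteOp R m) 1 (unitWord a b) =
      ((List.finRange r).map fun j => kron (siteFactor R m j (a j, b j))).prod := by
    simp [wordProd, unitWord, siteOp, Function.comp_def]
  rw [this, kron_list_prod, funext he, kron_smul, kron_single, Finset.prod_pow_eq_pow_sum]

theorem swapOp_eq_swapForm (m i : ℕ) (h : i + 1 < r) :
    swapOp R m r i h (N := N) =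
      swapForm (fun _ _ => 0) (sgn R m) ⟨i, Nat.lt_of_succ_lt h⟩ ⟨i + 1, h⟩ :=
  twoSiteOp_eq_swapForm _ _ _ (fun p p' => by simp [Pent, eq_comm]) i h

theorem sgn_comm (m : ℕ) (a b : Fin N) : sgn R m a b = sgn R m b a := by
  rw [sgn, sgn, mul_comm]

theorem sgn_mul_self (m : ℕ) (a b : Fin N) : sgn R m a b * sgn R m a b = 1 := by
  rw [sgn, ← mul_pow]
  simp

theorem swapOp_mul_self (m i : ℕ) (h : i + 1 < r) :
    swapOp R m r i h (N := N) * swapOp R m r i h = 1 := by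
  rw [swapOp_eq_swapForm]
  ext a b
  rw [swapForm_mul_apply]
  simp only [swapForm, Function.comp_apply, Equiv.swap_apply_left, Equiv.swap_apply_right,
    zero_mul, zero_add, Function.comp_assoc]
  rw [sgn_comm m (a ⟨i + 1, h⟩), ← mul_assoc, sgn_mul_self, one_mul]
  simp [Matrix.one_apply, funext_iff]

theorem intertwines_diagonal {D O : Fin N → Fin N → R} (hO : ∀ a b, O a b = O b a)
    (f : Fin N → R) :
    Intertwines D O
      (fun a b c d => Matrix.diagonal f a c * Matrix.diagonal f b d)
      (fun a b c d => Matrix.diagonal f a c * Matrix.diagonal f b d) := by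
  intro a b c d
  simp only [Matrix.diagonal_apply, mul_ite, ite_mul, mul_zero, zero_mul]
  have h := hO a b
  congr 1
  · split_ifs <;> simp_all
  · split_ifs <;> simp_all [mul_comm]

theorem swapOp_mul_siteOp (m i : ℕ) (h : i + 1 < r) (j : Fin r) (x : Fin N × Fin N) :
    swapOp R m r i h * siteOp R m j x =
      siteOp R m (Equiv.swap ⟨i, Nat.lt_of_succ_lt h⟩ ⟨i + 1, h⟩ j) x * swapOp R m r i h := by
  rw [swapOp_eq_swapForm]
  generalize hs : (⟨i, Nat.lt_of_succ_lt h⟩ : Fin r) = s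
  generalize ht : (⟨i + 1, h⟩ : Fin r) = t
  have hst : s < t := by simp [← hs, ← ht, Fin.lt_def]
  have hlt (l : Fin r) (h1 : l ≠ t) : l < t ↔ l < s ∨ l = s := by
    simp only [← hs, ← ht, Fin.lt_def, Fin.ext_iff, ne_eq] at *
    omega
  have hgt (l : Fin r) (h1 : l ≠ s) : s < l ↔ t < l ∨ t = l := by
    simp only [← hs, ← ht, Fin.lt_def, Fin.ext_iff, ne_eq] at *
    omega
  have hdeg (a b c d : Fin N) (h : x.1 = a) (h' : x.2 = b) (hcd : c = d) :
      sgn R m a c = sgn R m d b * (-1) ^ (unitDeg m x * deg m c) := by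
    subst h h' hcd
    rw [sgn, sgn, ← pow_add, unitDeg]
    have : deg m c * deg m x.2 + (deg m x.1 + deg m x.2) * deg m c =
      deg m x.1 * deg m c + 2 * (deg m c * deg m x.2) := by ring
    rw [this, pow_add, pow_mul]
    simp
  have hsq (e : ℕ) : ((-1 : R) ^ e) * (-1) ^ e = 1 := by
    rw [← mul_pow]
    simp
  refine swapForm_mul_kron hst.ne ?_ ?_
  · intro l h1 h2
    by_cases hjs : j = s
    · subst hjs
      simp [siteFactor, h1, h2, hlt]
    by_cases hjt : j = t
    · subst hjt
      simp [siteFactor, h1, h2, hlt]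
    rw [Equiv.swap_apply_of_ne_of_ne hjs hjt]
  · by_cases hjs : j = s
    · subst hjs
      intro a b c d
      simp only [siteFactor, Equiv.swap_apply_left, hst, hst.not_gt, hst.ne', if_true, if_false,
        lt_irrefl, Smat_pow_eq_diagonal, Matrix.single_apply, Matrix.one_apply,
        Matrix.diagonal_apply, zero_mul, zero_add]
      have := hdeg b c a d
      split_ifs <;> simp_all [sgn_comm]
    by_cases hjt : j = t
    · subst hjt
      intro a b c d
      simp only [siteFactor, Equiv.swap_apply_right, hst, hst.not_gt, hst.ne', if_true, if_false,
        lt_irrefl, Smat_pow_eq_diagonal, Matrix.single_apply, Matrix.one_apply,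
        Matrix.diagonal_apply, zero_mul, zero_add]
      have := hdeg a d b c
      split_ifs <;> simp_all [sgn_comm, mul_assoc]
    rw [Equiv.swap_apply_of_ne_of_ne hjs hjt]
    rcases lt_or_gt_of_ne hjs with h' | h'
    · simp only [siteFactor, h'.not_gt, (h'.trans hst).not_gt, h'.ne', (h'.trans hst).ne',
        if_false]
      simpa only [Matrix.diagonal_one] using
        intertwines_diagonal (D := fun _ _ => 0) (sgn_comm m) fun _ : Fin N => (1 : R)
    · have h'' : t < j := ((hgt j hjs).1 h').resolve_right (Ne.symm hjt)
      simp only [siteFactor, h', h'', if_true, Smat_pow_eq_diagonal]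
      exact intertwines_diagonal (sgn_comm m) _

end SiteOp

section Classical

variable {k : Type*} [Field k] {N r : ℕ}

/-- Every permutation of the sites is implemented on one-site operators by conjugation with an
invertible operator in the algebra generated by the signed swaps. -/
theorem exists_perm_implementer (m : ℕ) {X : Matrix (Fin r → Fin N) (Fin r → Fin N) k}
    (hX : ∀ i h, swapOp k m r i h * X = X * swapOp k m r i h) (σ : Equiv.Perm (Fin r)) :
    ∃ g g' : Matrix (Fin r → Fin N) (Fin r → Fin N) k, g * g' = 1 ∧ g * X = X * g ∧
      ∀ j x, g * siteOp k m j x = siteOp k m (σ j) x * g := by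
  cases r with
  | zero => exact ⟨1, 1, by simp, by simp, fun j => j.elim0⟩
  | succ r =>
    have hσ : σ ∈ Submonoid.closure
        (Set.range fun i : Fin r => Equiv.swap i.castSucc i.succ) := by
      rw [Equiv.Perm.mclosure_swap_castSucc_succ]
      trivial
    induction hσ using Submonoid.closure_induction with
    | mem σ h =>
      obtain ⟨i, rfl⟩ := h
      have hi : (i : ℕ) + 1 < r + 1 := by omega
      exact ⟨swapOp k m (r + 1) i hi, swapOp k m (r + 1) i hi, swapOp_mul_self m i hi, hX i hi,
        swapOp_mul_siteOp m i hi⟩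
    | one => exact ⟨1, 1, by simp, by simp, by simp⟩
    | mul σ τ _ _ ihσ ihτ =>
      obtain ⟨g, g', hg, hgX, hgu⟩ := ihσ
      obtain ⟨f, f', hf, hfX, hfu⟩ := ihτ
      refine ⟨g * f, f' * g', ?_, ?_, fun j x => ?_⟩
      · rw [mul_assoc, ← mul_assoc f, hf, one_mul, hg]
      · rw [mul_assoc, hfX, ← mul_assoc, hgX, mul_assoc]
      · rw [mul_assoc, hfu, ← mul_assoc, hgu, mul_assoc, Equiv.Perm.mul_apply]

/-- Over a field of characteristic zero, an operator commuting with the signed swaps is a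
polynomial in the coproducts of the matrix units. -/
theorem mem_of_commute_swapOp [CharZero k] (m : ℕ)
    {X : Matrix (Fin r → Fin N) (Fin r → Fin N) k}
    (hX : ∀ i h, swapOp k m r i h * X = X * swapOp k m r i h)
    (B : Subalgebra k (Matrix (Fin r → Fin N) (Fin r → Fin N) k))
    (hB : ∀ x, ∑ j, siteOp k m j x ∈ B) : X ∈ B := by
  choose e he using exists_wordProd_unitWord (R := k) (N := N) (r := r) m
  have hexp : X = ∑ a, ∑ b, (X a b * (-1) ^ e a b) •
      wordProd (siteOp k m) 1 (unitWord a b) := by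
    conv_lhs => rw [Matrix.matrix_eq_sum_single X]
    refine Finset.sum_congr rfl fun a _ => Finset.sum_congr rfl fun b _ => ?_
    rw [he, smul_smul, mul_assoc, ← mul_pow]
    simp
  have hword (σ : Equiv.Perm (Fin r)) {g : Matrix (Fin r → Fin N) (Fin r → Fin N) k}
      (hg : ∀ j x, g * siteOp k m j x = siteOp k m (σ j) x * g)
      (w : List (Fin r × (Fin N × Fin N))) :
      g * wordProd (siteOp k m) 1 w = wordProd (siteOp k m) σ w * g := by
    induction w with
    | nil => simp [wordProd]
    | cons p w ih =>
      rw [wordProd_cons, wordProd_cons, ← mul_assoc, Equiv.Perm.one_apply, hg, mul_assoc, ih,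
        mul_assoc]
  have hσ (σ : Equiv.Perm (Fin r)) : X = ∑ a, ∑ b, (X a b * (-1) ^ e a b) •
      wordProd (siteOp k m) σ (unitWord a b) := by
    obtain ⟨g, g', hgg, hgX, hgu⟩ := exists_perm_implementer m hX σ
    have h1 : g * X = (∑ a, ∑ b, (X a b * (-1) ^ e a b) •
        wordProd (siteOp k m) σ (unitWord a b)) * g := by
      conv_lhs => rw [hexp]
      simp_rw [Finset.mul_sum, Finset.sum_mul, mul_smul_comm, smul_mul_assoc, hword σ hgu]
    rw [hgX] at h1
    have h2 := congrArg (· * g') h1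
    simpa only [mul_assoc, hgg, mul_one] using h2
  have hsum : (Fintype.card (Equiv.Perm (Fin r)) : k) • X = ∑ a, ∑ b,
      (X a b * (-1) ^ e a b) • ∑ σ, wordProd (siteOp k m) σ (unitWord a b) := by
    rw [Nat.cast_smul_eq_nsmul, ← Finset.card_univ, ← Finset.sum_const]
    simp_rw [Finset.smul_sum]
    rw [Finset.sum_congr rfl fun σ _ => hσ σ, Finset.sum_comm]
    exact Finset.sum_congr rfl fun a _ => Finset.sum_comm
  have hmem : (Fintype.card (Equiv.Perm (Fin r)) : k) • X ∈ B := by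
    rw [hsum]
    refine B.sum_mem fun a _ => B.sum_mem fun b _ => B.smul_mem ?_ _
    refine sum_wordProd_mem ?_ ?_ B hB _ _ rfl
    · exact fun x y => ⟨_, fun i j hij => siteOp_mul_siteOp_of_ne m x y hij⟩
    · rintro ⟨a, b⟩ ⟨c, d⟩
      by_cases h : b = c
      · subst h
        exact ⟨1, (a, d), fun j => by rw [siteOp_mul_siteOp_self, one_smul]⟩
      · exact ⟨0, (a, d), fun j => by rw [siteOp_mul_siteOp_eq_zero m j h, zero_smul]⟩
  exact (B.toSubmodule.smul_mem_iff (Nat.cast_ne_zero.2 Fintype.card_ne_zero)).1 hmem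

theorem sum_siteOp_mul_sub (m : ℕ) {a b c : Fin N} (h : a ≠ c) :
    (∑ j : Fin r, siteOp k m j (a, b)) * ∑ j, siteOp k m j (b, c) -
      (-1 : k) ^ (unitDeg m (a, b) * unitDeg m (b, c)) •
        ((∑ j, siteOp k m j (b, c)) * ∑ j, siteOp k m j (a, b)) =
      ∑ j, siteOp k m j (a, c) := by
  have h1 : (∑ j : Fin r, siteOp k m j (b, c)) * ∑ j, siteOp k m j (a, b) =
      ∑ i : Fin r, ∑ j, siteOp k m j (b, c) * siteOp k m i (a, b) := by
    rw [Finset.sum_mul_sum, Finset.sum_comm]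
  rw [h1, Finset.sum_mul_sum, Finset.smul_sum, ← Finset.sum_sub_distrib]
  refine Finset.sum_congr rfl fun i _ => ?_
  rw [Finset.smul_sum, ← Finset.sum_sub_distrib, Finset.sum_eq_single i]
  · rw [siteOp_mul_siteOp_self, siteOp_mul_siteOp_eq_zero m i h.symm, smul_zero, sub_zero]
  · intro j _ hj
    rw [siteOp_mul_siteOp_of_ne m _ _ hj.symm, sub_self]
  · simp

/-- The coproducts of all matrix units lie in any algebra containing those of the simple root
vectors and of the diagonal matrix units. -/
theorem sum_siteOp_mem (m : ℕ) (B : Subalgebra k (Matrix (Fin r → Fin N) (Fin r → Fin N) k))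
    (hdiag : ∀ a, ∑ j, siteOp k m j (a, a) ∈ B)
    (hup : ∀ (l : ℕ) (h : l + 1 < N),
      ∑ j, siteOp k m j (⟨l + 1, h⟩, ⟨l, Nat.lt_of_succ_lt h⟩) ∈ B)
    (hdown : ∀ (l : ℕ) (h : l + 1 < N),
      ∑ j, siteOp k m j (⟨l, Nat.lt_of_succ_lt h⟩, ⟨l + 1, h⟩) ∈ B)
    (x : Fin N × Fin N) : ∑ j, siteOp k m j x ∈ B := by
  have hbracket {a b c : Fin N} (h : a ≠ c) (hab : ∑ j, siteOp k m j (a, b) ∈ B)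
      (hbc : ∑ j, siteOp k m j (b, c) ∈ B) : ∑ j, siteOp k m j (a, c) ∈ B := by
    rw [← sum_siteOp_mul_sub m h]
    exact B.sub_mem (B.mul_mem hab hbc) (B.smul_mem (B.mul_mem hbc hab) _)
  have key (d : ℕ) : ∀ (l : ℕ) (h : l + d + 1 < N),
      ∑ j, siteOp k m j (⟨l, by omega⟩, ⟨l + d + 1, h⟩) ∈ B ∧
        ∑ j, siteOp k m j (⟨l + d + 1, h⟩, ⟨l, by omega⟩) ∈ B := by
    induction d with
    | zero => exact fun l h => ⟨hdown l h, hup l h⟩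
    | succ d ih =>
      intro l h
      obtain ⟨h1, h2⟩ := ih l (by omega)
      exact ⟨hbracket (by simp [Fin.ext_iff]; omega) h1 (hdown (l + d + 1) h),
        hbracket (by simp [Fin.ext_iff]; omega) (hup (l + d + 1) h) h2⟩
  obtain ⟨⟨a, ha⟩, ⟨b, hb⟩⟩ := x
  rcases lt_trichotomy a b with h | rfl | h
  · obtain ⟨d, rfl⟩ := Nat.exists_eq_add_of_lt h
    exact (key d a hb).1
  · exact hdiag _
  · obtain ⟨d, rfl⟩ := Nat.exists_eq_add_of_lt h
    exact (key d b ha).2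

end Classical

section Generators

variable {R : Type*} [CommRing R] {N r : ℕ}

theorem Dmat_eq_diagonal (x xinv : R) (m l : ℕ) : Dmat x xinv m l (N := N) =
    Matrix.diagonal fun a : Fin N => if (a : ℕ) = l then (if l < m then x else xinv)
      else if (a : ℕ) = l + 1 then (if l + 1 < m then xinv else x) else 1 := by
  ext a b
  simp [Dmat, Matrix.diagonal_apply]

theorem Dmat_one_one (m l : ℕ) : Dmat (1 : R) 1 m l (N := N) = 1 := by
  rw [Dmat_eq_diagonal, ← Matrix.diagonal_one]
  congr 1
  ext a
  split_ifs <;> rfl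

theorem Emat_eq_single (l : ℕ) (h : l + 1 < N) : Emat R l =
    Matrix.single (⟨l + 1, h⟩ : Fin N) ⟨l, Nat.lt_of_succ_lt h⟩ 1 := by
  ext a b
  simp [Emat, Matrix.single_apply, Fin.ext_iff, eq_comm]

theorem Fmat_eq_single (l : ℕ) (h : l + 1 < N) : Fmat R l =
    Matrix.single (⟨l, Nat.lt_of_succ_lt h⟩ : Fin N) ⟨l + 1, h⟩ 1 := by
  ext a b
  simp [Fmat, Matrix.single_apply, Fin.ext_iff, eq_comm]

theorem SPmat_eq_Smat_pow (m l : ℕ) (h : l + 1 < N) : SPmat R m l (N := N) =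
    Smat R m ^ (deg m (⟨l + 1, h⟩ : Fin N) + deg m (⟨l, Nat.lt_of_succ_lt h⟩ : Fin N)) := by
  rcases lt_trichotomy (l + 1) m with h' | h' | h'
  · simp [SPmat, deg, h', h'.ne, (Nat.lt_succ_self l).trans h']
  · have h1 : l < m := by omega
    simp [SPmat, deg, h', h1]
  · have h1 : ¬ l < m := by omega
    simp [SPmat, deg, h'.not_gt, h'.ne', h1]
    simpa using (Smat_pow_two_mul (R := R) (N := N) m 1).symm

theorem rhoE_one_one (m l : ℕ) (h : l + 1 < N) : rhoE (1 : R) 1 m r l (N := N) =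
    ∑ j, siteOp R m j (⟨l + 1, h⟩, ⟨l, Nat.lt_of_succ_lt h⟩) := by
  simp only [rhoE, siteOp, Dinvmat, Dmat_one_one, Emat_eq_single l h, SPmat_eq_Smat_pow m l h]
  rfl

theorem rhoF_one_one (m l : ℕ) (h : l + 1 < N) : rhoF (1 : R) 1 m r l (N := N) =
    ∑ j, siteOp R m j (⟨l, Nat.lt_of_succ_lt h⟩, ⟨l + 1, h⟩) := by
  simp only [rhoF, siteOp, Dmat_one_one, Fmat_eq_single l h, SPmat_eq_Smat_pow m l h, mul_one,
    add_comm (deg m (⟨l + 1, h⟩ : Fin N))]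
  rfl

theorem sum_siteOp_diag (m : ℕ) (c : Fin N) : ∑ j : Fin r, siteOp R m j (c, c) =
    Matrix.diagonal fun a : Fin r → Fin N =>
      ((Finset.univ.filter fun j => a j = c).card : R) := by
  have hfac (j : Fin r) : siteOp R m j (c, c) =
      Matrix.diagonal fun a : Fin r → Fin N => if a j = c then 1 else 0 := by
    have h2 : unitDeg m (c, c) = 2 * deg m c := by
      simp only [unitDeg]
      ring
    ext a b
    rw [siteOp, kron, Matrix.diagonal_apply]
    have (i : Fin r) : siteFactor R m j (c, c) i (a i) (b i) =
        if a i = b i ∧ (i = j → a i = c) then 1 else 0 := by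
      rcases lt_trichotomy i j with h | rfl | h
      · simp [siteFactor, h, h2, Smat_pow_two_mul, h.ne, Matrix.one_apply]
      · simp only [siteFactor, lt_irrefl, if_false, if_true, Matrix.single_apply, true_imp_iff]
        congr 1
        apply propext
        constructor
        · rintro ⟨h1, h2⟩
          exact ⟨h1.symm.trans h2, h1.symm⟩
        · rintro ⟨h1, h2⟩
          exact ⟨h2.symm, h2.symm.trans h1⟩
      · simp [siteFactor, h.not_gt, h.ne', Matrix.one_apply]
    simp_rw [this]
    rw [Finset.prod_ite_zero, Finset.prod_const_one, ← ite_and]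
    congr 1
    apply propext
    simp [funext_iff, forall_and]
  simp_rw [hfac]
  ext a b
  rw [Matrix.sum_apply, Matrix.diagonal_apply]
  by_cases h : a = b
  · simp [h]
  · simp [h]

theorem rhoQ_eq_diagonal (x : R) (c : Fin N) : rhoQ x r c =
    Matrix.diagonal fun a : Fin r → Fin N =>
      x ^ (Finset.univ.filter fun j => a j = c).card := by
  ext a b
  simp only [rhoQ, kron, Qmat, Matrix.diagonal_apply]
  rw [Finset.prod_ite_zero]
  simp [funext_iff, Finset.prod_ite]

end Generators

section Commutation

variable {R : Type*} [CommRing R] {N r : ℕ}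

/-- The diagonal coefficient of `v_k ⊗ v_l` in `T (v_k ⊗ v_l)`. -/
def heckeDiag (x xinv : R) (m : ℕ) (a b : Fin N) : R :=
  if a = b then (if (a : ℕ) < m then x else -xinv) else if a < b then x - xinv else 0

/-- The coefficient of `v_l ⊗ v_k` in `T (v_k ⊗ v_l)`, taken to be zero when `k = l`. -/
def heckeOff (R : Type*) [CommRing R] (m : ℕ) (a b : Fin N) : R :=
  if a = b then 0 else sgn R m a b

theorem heckeOp_eq_swapForm (x xinv : R) (m i : ℕ) (h : i + 1 < r) :
    heckeOp x xinv m r i h (N := N) =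
      swapForm (heckeDiag x xinv m) (heckeOff R m) ⟨i, Nat.lt_of_succ_lt h⟩ ⟨i + 1, h⟩ := by
  refine twoSiteOp_eq_swapForm _ _ _ (fun p p' => ?_) i h
  simp only [Tent, heckeDiag, heckeOff, Fin.lt_def, eq_comm (a := p')]
  split_ifs <;> simp_all [add_comm]

theorem heckeOff_comm (m : ℕ) (a b : Fin N) : heckeOff R m a b = heckeOff R m b a := by
  simp only [heckeOff, eq_comm (a := a), sgn_comm m a]

theorem swapForm_mul_sum_coproduct {D O : Fin N → Fin N → R} {A X Z : Matrix (Fin N) (Fin N) R}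
    (hA : Intertwines D O (fun a b c d => A a c * A b d) (fun a b c d => A a c * A b d))
    (hZ : Intertwines D O (fun a b c d => Z a c * Z b d) (fun a b c d => Z a c * Z b d))
    (hX : Intertwines D O (fun a b c d => X a c * Z b d + A a c * X b d)
      (fun a b c d => X a c * Z b d + A a c * X b d)) (i : ℕ) (h : i + 1 < r) :
    swapForm D O ⟨i, Nat.lt_of_succ_lt h⟩ ⟨i + 1, h⟩ *
        ∑ p : Fin r, kron (fun j => if j < p then A else if j = p then X else Z) =
      (∑ p : Fin r, kron (fun j => if j < p then A else if j = p then X else Z)) *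
        swapForm D O ⟨i, Nat.lt_of_succ_lt h⟩ ⟨i + 1, h⟩ := by
  generalize hs : (⟨i, Nat.lt_of_succ_lt h⟩ : Fin r) = s
  generalize ht : (⟨i + 1, h⟩ : Fin r) = t
  have hst : s < t := by simp [← hs, ← ht, Fin.lt_def]
  have hlt (l : Fin r) (h1 : l ≠ s) (h2 : l ≠ t) : l < t ↔ l < s := by
    simp only [← hs, ← ht, Fin.lt_def, Fin.ext_iff, ne_eq] at *
    omega
  rw [← Finset.sum_sdiff (Finset.subset_univ {s, t}), mul_add, add_mul]
  congr 1
  · rw [Finset.mul_sum, Finset.sum_mul]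
    refine Finset.sum_congr rfl fun p hp => ?_
    simp only [Finset.mem_sdiff, Finset.mem_univ, true_and, Finset.mem_insert,
      Finset.mem_singleton, not_or] at hp
    refine swapForm_mul_kron hst.ne (fun _ _ _ => rfl) ?_
    rcases lt_or_gt_of_ne hp.1 with h' | h'
    · simpa [h'.not_gt, (h'.trans hst).not_gt, h'.ne', (h'.trans hst).ne'] using hZ
    · have h'' : t < p :=
        (lt_or_gt_of_ne hp.2).resolve_left fun h3 => h'.not_gt ((hlt p hp.1 hp.2).1 h3)
      simpa [h', h''] using hA
  · refine swapForm_mul_sum_kron _ hst.ne (rest := fun j => if j < s then A else Z) ?_ ?_ ?_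
    · intro p hp j h1 h2
      rcases Finset.mem_insert.1 hp with rfl | hp
      · simp [h1]
      · rw [Finset.mem_singleton] at hp
        subst hp
        simp [h2, hlt j h1 h2]
    · intro p hp j h1 h2
      rcases Finset.mem_insert.1 hp with rfl | hp
      · simp [h1]
      · rw [Finset.mem_singleton] at hp
        subst hp
        simp [h2, hlt j h1 h2]
    · simpa [Finset.sum_pair hst.ne, hst, hst.not_gt, hst.ne'] using hX

theorem SPmat_eq_diagonal (m l : ℕ) : SPmat R m l (N := N) =
    Matrix.diagonal fun a => if l + 1 = m then (-1) ^ deg m a else 1 := by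
  by_cases h : l + 1 = m <;> simp [SPmat, h, Smat_eq_diagonal]

theorem neg_one_pow_deg (m : ℕ) (a : Fin N) :
    (-1 : R) ^ deg m a = if (a : ℕ) < m then 1 else -1 := by
  unfold deg
  split_ifs <;> simp

theorem heckeOff_eq_ite (m : ℕ) (a b : Fin N) : heckeOff R m a b =
    if a = b then 0 else if (a : ℕ) < m then 1 else if (b : ℕ) < m then 1 else -1 := by
  simp only [heckeOff, sgn, deg]
  split_ifs <;> simp

theorem heckeOp_mul_kron_diagonal (x xinv : R) (m i : ℕ) (h : i + 1 < r) (f : Fin N → R) :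
    heckeOp x xinv m r i h * kron (fun _ => Matrix.diagonal f) =
      kron (fun _ => Matrix.diagonal f) * heckeOp x xinv m r i h := by
  rw [heckeOp_eq_swapForm]
  exact swapForm_mul_kron (by simp) (fun _ _ _ => rfl)
    (intertwines_diagonal (heckeOff_comm m) f)

theorem heckeOp_mul_rhoE {x xinv : R} (hx : x * xinv = 1) (m l i : ℕ) (h : i + 1 < r) :
    heckeOp x xinv m r i h (N := N) * rhoE x xinv m r l =
      rhoE x xinv m r l * heckeOp x xinv m r i h := by
  rw [heckeOp_eq_swapForm, rhoE]
  refine swapForm_mul_sum_coproduct ?_ ?_ ?_ i h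
  · rw [SPmat_eq_diagonal]
    exact intertwines_diagonal (heckeOff_comm m) _
  · rw [Dinvmat, Dmat_eq_diagonal]
    exact intertwines_diagonal (heckeOff_comm m) _
  · rintro ⟨a, ha⟩ ⟨b, hb⟩ ⟨c, hc⟩ ⟨d, hd⟩
    simp only [heckeDiag, heckeOff_eq_ite, neg_one_pow_deg, Emat, Dinvmat, Dmat, SPmat_eq_diagonal,
      Matrix.diagonal_apply, Fin.mk.injEq, Fin.mk_lt_mk]
    rcases lt_trichotomy (l + 1) m with hl | hl | hl <;>
      by_cases h1 : a = l + 1 <;> by_cases h2 : b = l + 1 <;> by_cases h3 : c = l <;>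
      by_cases h4 : d = l <;> grind

theorem heckeOp_mul_rhoF {x xinv : R} (hx : x * xinv = 1) (m l i : ℕ) (h : i + 1 < r) :
    heckeOp x xinv m r i h (N := N) * rhoF x xinv m r l =
      rhoF x xinv m r l * heckeOp x xinv m r i h := by
  rw [heckeOp_eq_swapForm, rhoF]
  refine swapForm_mul_sum_coproduct ?_ ?_ ?_ i h
  · rw [SPmat_eq_diagonal, Dmat_eq_diagonal, Matrix.diagonal_mul_diagonal]
    exact intertwines_diagonal (heckeOff_comm m) _
  · rw [← Matrix.diagonal_one]
    exact intertwines_diagonal (heckeOff_comm m) _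
  · rintro ⟨a, ha⟩ ⟨b, hb⟩ ⟨c, hc⟩ ⟨d, hd⟩
    simp only [heckeDiag, heckeOff_eq_ite, neg_one_pow_deg, Fmat, Dmat_eq_diagonal,
      SPmat_eq_diagonal, Matrix.diagonal_mul_diagonal, Matrix.diagonal_apply, Matrix.one_apply,
      Fin.mk.injEq, Fin.mk_lt_mk]
    rcases lt_trichotomy (l + 1) m with hl | hl | hl <;>
      by_cases h1 : a = l <;> by_cases h2 : b = l <;> by_cases h3 : c = l + 1 <;>
      by_cases h4 : d = l + 1 <;> grind

theorem heckeOp_mul_of_mem_quantumGens {x xinv : R} (hx : x * xinv = 1) (m i : ℕ)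
    (h : i + 1 < r) {M : Matrix (Fin r → Fin N) (Fin r → Fin N) R}
    (hM : M ∈ quantumGens x xinv m r) :
    heckeOp x xinv m r i h * M = M * heckeOp x xinv m r i h := by
  have hQ (y : R) (b : Fin N) :
      Qmat y b = Matrix.diagonal fun a => if a = b then y else 1 := by
    ext a c
    simp [Qmat, Matrix.diagonal_apply]
  obtain (((rfl | ⟨b, rfl⟩) | ⟨b, rfl⟩) | ⟨l, rfl⟩) | ⟨l, rfl⟩ := hM
  · simp only [rhoSigma, Smat_eq_diagonal, heckeOp_mul_kron_diagonal]
  · simp only [rhoQ, hQ, heckeOp_mul_kron_diagonal]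
  · simp only [rhoQ, hQ, heckeOp_mul_kron_diagonal]
  · exact heckeOp_mul_rhoE hx m l i h
  · exact heckeOp_mul_rhoF hx m l i h

end Commutation

section RingHom

variable {R S : Type*} [CommRing R] [CommRing S] {N r : ℕ} (f : R →+* S)

theorem map_twoSiteOp (E : Fin N × Fin N → Fin N × Fin N → R) (i : ℕ) (h : i + 1 < r) :
    (twoSiteOp E r i h).map f = twoSiteOp (fun p p' => f (E p p')) r i h := by
  ext a b
  simp [twoSiteOp, apply_ite f]

theorem map_heckeOp (x xinv : R) (m i : ℕ) (h : i + 1 < r) :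
    (heckeOp x xinv m r i h (N := N)).map f = heckeOp (f x) (f xinv) m r i h := by
  rw [heckeOp, map_twoSiteOp, heckeOp]
  congr 1
  ext p p'
  simp [Tent, sgn, apply_ite f]

theorem map_SPmat (m l : ℕ) : (SPmat R m l (N := N)).map f = SPmat S m l := by
  rw [SPmat_eq_diagonal, SPmat_eq_diagonal, Matrix.diagonal_map f.map_zero]
  simp [apply_ite f]

theorem map_Dmat (x xinv : R) (m l : ℕ) :
    (Dmat x xinv m l (N := N)).map f = Dmat (f x) (f xinv) m l := by
  ext a b
  simp [Dmat, apply_ite f]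

theorem map_Emat (l : ℕ) : (Emat R l (N := N)).map f = Emat S l := by
  ext a b
  simp [Emat, apply_ite f]

theorem map_Fmat (l : ℕ) : (Fmat R l (N := N)).map f = Fmat S l := by
  ext a b
  simp [Fmat, apply_ite f]

theorem map_sum_coproduct (A X Z : Matrix (Fin N) (Fin N) R) :
    (∑ p : Fin r, kron (fun j => if j < p then A else if j = p then X else Z)).map f =
      ∑ p : Fin r, kron fun j =>
        if j < p then A.map f else if j = p then X.map f else Z.map f := by
  ext a b
  simp only [Matrix.map_apply, Matrix.sum_apply, map_sum, kron, map_prod]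
  refine Finset.sum_congr rfl fun p _ => Finset.prod_congr rfl fun j _ => ?_
  split_ifs <;> rfl

theorem map_rhoE (x xinv : R) (m l : ℕ) :
    (rhoE x xinv m r l (N := N)).map f = rhoE (f x) (f xinv) m r l := by
  rw [rhoE, map_sum_coproduct, map_SPmat, map_Emat, Dinvmat, map_Dmat]
  rfl

theorem map_rhoF (x xinv : R) (m l : ℕ) :
    (rhoF x xinv m r l (N := N)).map f = rhoF (f x) (f xinv) m r l := by
  rw [rhoF, map_sum_coproduct, Matrix.map_mul, map_SPmat, map_Dmat, map_Fmat,
    Matrix.map_one f f.map_zero f.map_one]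
  rfl

theorem heckeOp_one_one (m i : ℕ) (h : i + 1 < r) :
    heckeOp (1 : R) 1 m r i h (N := N) = swapOp R m r i h := by
  rw [heckeOp, swapOp]
  congr 1
  ext ⟨a, b⟩ p'
  by_cases hab : a = b
  · subst hab
    by_cases h' : (a : ℕ) < m <;> simp [Tent, Pent, sgn, deg, h']
  · simp [Tent, Pent, hab]

end RingHom

noncomputable section Specialization

/-- The rational function underlying an element of `valueAtOne`. -/
def toRatFunc : valueAtOne →+* 𝕂 := (RingHom.fst 𝕂 ℚ).comp valueAtOne.subtype

/-- The value at `1` of an element of `valueAtOne`. -/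
def evalOne : valueAtOne →+* ℚ := (RingHom.snd 𝕂 ℚ).comp valueAtOne.subtype

theorem toRatFunc_injective : Function.Injective toRatFunc := by
  rw [injective_iff_map_eq_zero]
  rintro ⟨⟨f, a⟩, h⟩ (rfl : f = 0)
  simp [eq_zero_of_mem_valueAtOne h]

/-- `q` as an element of `valueAtOne`. -/
def qAtOne : valueAtOne := ⟨(q, 1), q_mem_valueAtOne⟩

/-- `q⁻¹` as an element of `valueAtOne`. -/
def qInvAtOne : valueAtOne := ⟨(q⁻¹, 1), q_inv_mem_valueAtOne⟩

/-- Passage to the value at `1` preserves commutation with the operators `T_i`. -/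
theorem swapOp_mul_map_evalOne {N r : ℕ} (m i : ℕ) (h : i + 1 < r)
    {M : Matrix (Fin r → Fin N) (Fin r → Fin N) valueAtOne}
    (hM : heckeOp q q⁻¹ m r i h * M.map toRatFunc = M.map toRatFunc * heckeOp q q⁻¹ m r i h) :
    swapOp ℚ m r i h * M.map evalOne = M.map evalOne * swapOp ℚ m r i h := by
  have h1 : heckeOp qAtOne qInvAtOne m r i h * M = M * heckeOp qAtOne qInvAtOne m r i h := by
    apply Matrix.map_injective toRatFunc_injective
    dsimp only
    rw [Matrix.map_mul, Matrix.map_mul, map_heckeOp]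
    exact hM
  have h2 := congrArg (fun M => M.map evalOne) h1
  rw [Matrix.map_mul, Matrix.map_mul, map_heckeOp] at h2
  rw [← heckeOp_one_one]
  exact h2

/-- Matrices acting on row vectors, as a linear equivalence onto the endomorphisms. -/
def vecMulEquiv (R I : Type*) [CommRing R] [Fintype I] [DecidableEq I] :
    Matrix I I R ≃ₗ[R] Module.End R (I → R) :=
  Matrix.toLinearMapRight'.toAddEquiv.toLinearEquiv fun c M => by
    ext
    simp

theorem vecMulEquiv_apply {R I : Type*} [CommRing R] [Fintype I] [DecidableEq I]
    (M : Matrix I I R) : vecMulEquiv R I M = M.vecMulLinear := rfl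

theorem vecMulLinear_mul {R I : Type*} [CommRing R] [Fintype I] (A B : Matrix I I R) :
    Matrix.vecMulLinear (A * B) = (Matrix.vecMulLinear B : Module.End R (I → R)) *
      (Matrix.vecMulLinear A : Module.End R (I → R)) := by
  ext
  simp

/-- The matrices over `ℚ` that are values at `1` of matrices of operators in `B`. -/
def valuesAtOne {I : Type*} [Fintype I] [DecidableEq I]
    (B : Subalgebra 𝕂 (Module.End 𝕂 (I → 𝕂))) : Subalgebra ℚ (Matrix I I ℚ) where
  carrier := {M₀ | ∃ M : Matrix I I valueAtOne, M.map evalOne = M₀ ∧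
    (Matrix.vecMulLinear (M.map toRatFunc) : Module.End 𝕂 (I → 𝕂)) ∈ B}
  mul_mem' := by
    rintro _ _ ⟨M, rfl, hM⟩ ⟨M', rfl, hM'⟩
    refine ⟨M * M', Matrix.map_mul, ?_⟩
    rw [Matrix.map_mul, vecMulLinear_mul]
    exact mul_mem hM' hM
  add_mem' := by
    rintro _ _ ⟨M, rfl, hM⟩ ⟨M', rfl, hM'⟩
    refine ⟨M + M', Matrix.map_add _ (map_add _) _ _, ?_⟩
    rw [Matrix.map_add _ (map_add _)]
    have := add_mem hM hM'
    rwa [← map_add] at this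
  algebraMap_mem' a := by
    refine ⟨Matrix.diagonal fun _ => ⟨(algebraMap ℚ 𝕂 a, a), const_mem_valueAtOne a⟩, ?_, ?_⟩
    · rw [Matrix.diagonal_map (map_zero _)]
      rfl
    · rw [Matrix.diagonal_map (map_zero _)]
      convert B.algebraMap_mem (algebraMap ℚ 𝕂 a) using 1
      ext i j
      simp [toRatFunc, Matrix.vecMul_diagonal, Pi.single_apply]

theorem mem_valuesAtOne_Bq {m n r : ℕ}
    {X : Matrix (Fin r → Fin (m + n)) (Fin r → Fin (m + n)) ℚ}
    (hX : ∀ i h, swapOp ℚ m r i h * X = X * swapOp ℚ m r i h) : X ∈ valuesAtOne (Bq m n r) := by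
  have hgen {M : Matrix (Fin r → Fin (m + n)) (Fin r → Fin (m + n)) 𝕂}
      (hM : M ∈ quantumGens q q⁻¹ m r) : M.vecMulLinear ∈ Bq m n r :=
    Algebra.subset_adjoin ⟨M, hM, rfl⟩
  refine mem_of_commute_swapOp m hX _ (sum_siteOp_mem m _ (fun c => ?_) ?_ ?_)
  · let M : Matrix (Fin r → Fin (m + n)) (Fin r → Fin (m + n)) valueAtOne :=
      Matrix.diagonal fun a => ⟨_, geom_mem_valueAtOne (Finset.univ.filter fun j => a j = c).card⟩
    refine ⟨M, ?_, ?_⟩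
    · rw [sum_siteOp_diag, Matrix.diagonal_map (map_zero _)]
      rfl
    · have h1 : M.map toRatFunc = (q - 1)⁻¹ • (rhoQ q r c - 1) := by
        rw [rhoQ_eq_diagonal, Matrix.diagonal_map (map_zero _), ← Matrix.diagonal_one,
          Matrix.diagonal_sub, ← Matrix.diagonal_smul]
        rfl
      have h2 : (Matrix.vecMulLinear (1 : Matrix (Fin r → Fin (m + n)) (Fin r → Fin (m + n)) 𝕂)
          : Module.End 𝕂 ((Fin r → Fin (m + n)) → 𝕂)) = 1 := by
        ext
        simp
      rw [h1, ← vecMulEquiv_apply, map_smul, map_sub, vecMulEquiv_apply, vecMulEquiv_apply, h2]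
      exact Subalgebra.smul_mem _ (sub_mem (hgen (by simp [quantumGens])) (one_mem _)) _
  · intro l h
    rw [← rhoE_one_one]
    refine ⟨rhoE qAtOne qInvAtOne m r l, map_rhoE _ _ _ _ _, ?_⟩
    rw [map_rhoE]
    exact hgen (Or.inl (Or.inr ⟨⟨l, by omega⟩, rfl⟩))
  · intro l h
    rw [← rhoF_one_one]
    refine ⟨rhoF qAtOne qInvAtOne m r l, map_rhoF _ _ _ _ _, ?_⟩
    rw [map_rhoF]
    exact hgen (Or.inr ⟨⟨l, by omega⟩, rfl⟩)

theorem Bq_eq_centralizer (m n r : ℕ) : Bq m n r =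
    Subalgebra.centralizer 𝕂 (Matrix.vecMulLinear '' heckeGens q q⁻¹ m (N := m + n) r) := by
  have hle : Bq m n r ≤
      Subalgebra.centralizer 𝕂 (Matrix.vecMulLinear '' heckeGens q q⁻¹ m (N := m + n) r) := by
    refine Algebra.adjoin_le ?_
    rintro _ ⟨M, hM, rfl⟩
    rw [SetLike.mem_coe, Subalgebra.mem_centralizer_iff]
    rintro _ ⟨_, ⟨i, h, rfl⟩, rfl⟩
    rw [← vecMulLinear_mul, ← vecMulLinear_mul,
      heckeOp_mul_of_mem_quantumGens (mul_inv_cancel₀ q_ne_zero) m i h hM]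
  refine le_antisymm hle ?_
  let Φ : ((Fin r → Fin (m + n)) × (Fin r → Fin (m + n)) → 𝕂) ≃ₗ[𝕂]
      Module.End 𝕂 ((Fin r → Fin (m + n)) → 𝕂) :=
    LinearEquiv.curry 𝕂 𝕂 _ _ ≪≫ₗ Matrix.ofLinearEquiv 𝕂 ≪≫ₗ vecMulEquiv 𝕂 _
  have key := le_of_specialization (B := (Subalgebra.toSubmodule (Bq m n r)).comap Φ.toLinearMap)
    (Submodule.comap_mono (f := Φ.toLinearMap) (Subalgebra.toSubmodule.monotone hle)) ?_
  · intro X hX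
    obtain ⟨v, rfl⟩ := Φ.surjective X
    exact key hX
  · intro P hP
    let M : Matrix (Fin r → Fin (m + n)) (Fin r → Fin (m + n)) valueAtOne :=
      fun a b => ⟨_, polynomial_mem_valueAtOne (P (a, b))⟩
    have hM (i : ℕ) (h : i + 1 < r) :
        swapOp ℚ m r i h * M.map evalOne = M.map evalOne * swapOp ℚ m r i h := by
      apply swapOp_mul_map_evalOne
      have := Subalgebra.mem_centralizer_iff 𝕂 |>.1 hP _ ⟨_, ⟨i, h, rfl⟩, rfl⟩
      apply (vecMulEquiv 𝕂 _).injective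
      refine (vecMulLinear_mul _ _).trans (Eq.trans ?_ (vecMulLinear_mul _ _).symm)
      exact this.symm
    obtain ⟨M', hM', hB⟩ := mem_valuesAtOne_Bq hM
    refine ⟨fun p => M'.map toRatFunc p.1 p.2, hB, fun p => ?_⟩
    have h1 : (P p).eval 1 = evalOne (M' p.1 p.2) := (congrFun (congrFun hM' p.1) p.2).symm
    rw [h1]
    exact (M' p.1 p.2).2

end Specialization

/-- Schur–Weyl reciprocity, second half. The centralizer in
`End_K(V^{⊗ r})` of `𝒜_q` equals `ℬ_q`. -/
theorem centralizer_Aq_eq_Bq (m n r : ℕ) (hm : 1 ≤ m) (hn : 1 ≤ n) (hr : 2 ≤ r) :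
    {X : Module.End 𝕂 ((Fin r → Fin (m + n)) → 𝕂) |
        ∀ Y ∈ (Aq m n r : Set (Module.End 𝕂 ((Fin r → Fin (m + n)) → 𝕂))), X * Y = Y * X}
      = (Bq m n r : Set (Module.End 𝕂 ((Fin r → Fin (m + n)) → 𝕂))) := by
  ext X
  rw [Bq_eq_centralizer, SetLike.mem_coe, Subalgebra.mem_centralizer_iff, Set.mem_ofPred_eq]
  refine ⟨fun h Y hY => (h Y (Algebra.subset_adjoin hY)).symm, fun h Y hY => ?_⟩
  have : Aq m n r ≤ Subalgebra.centralizer 𝕂 {X} := by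
    refine Algebra.adjoin_le fun Y hY => ?_
    rw [SetLike.mem_coe, Subalgebra.mem_centralizer_iff]
    rintro _ rfl
    exact (h Y hY).symm
  exact Subalgebra.mem_centralizer_iff 𝕂 |>.1 (this hY) X rfl
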